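/- Let p be a solution of the master equation of the lifted chain L whose initial distribution p(0) has finite entropy H[p(0)] < ∞. Assume: (i) for every t ≥ 0 the free energy F^π(t) is finite and the instantaneous entropy production rate e_p(t) is finite and locally integrable; (ii) the free-energy balance identity F^π(T) − F^π(0) + ∫₀^T e_p(t) dt = F̄(T) − F̄(0) + ∫₀^T ē_p(t) dt holds for all T > 0; (iii) the folded distribution p̄(t) converges pointwise to π̄ as t → ∞. Then lim_{T→∞} (1/T)·∫₀^T e_p(t) dt = ē_p if and only if lim_{T→∞} H[p(T)]/T = 0. -/

import Mathlib

open Filter MeasureTheory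

noncomputable section

/-- Right-hand side of the master equation of the lifted chain `L` at state `x`. -/
def mEqDeriv {S : Type} [Fintype S] [DecidableEq S] {n : ℕ}
    (q : S → S → ℝ) (v : S → S → (Fin n → ℤ))
    (f : S × (Fin n → ℤ) → ℝ) (x : S × (Fin n → ℤ)) : ℝ :=
  ∑ j ∈ Finset.univ.erase x.1,
    (f (j, x.2 + v x.1 j) * q j x.1 - f x * q x.1 j)

/-- `p` is a solution of the master equation of the lifted chain `L`. -/
def IsMasterSolution {S : Type} [Fintype S] [DecidableEq S] {n : ℕ}
    (q : S → S → ℝ) (v : S → S → (Fin n → ℤ))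
    (p : ℝ → S × (Fin n → ℤ) → ℝ) : Prop :=
  (∀ t : ℝ, 0 ≤ t → (∀ x, 0 ≤ p t x) ∧ (∑' x, p t x) = 1) ∧
  (∀ (x : S × (Fin n → ℤ)) (t : ℝ), 0 ≤ t →
    HasDerivWithinAt (fun s => p s x) (mEqDeriv q v (p t) x) (Set.Ici 0) t)

/-- Instantaneous entropy production rate of the lifted chain at a distribution `f`. -/
def epL {S : Type} [Fintype S] [DecidableEq S] {n : ℕ}
    (q : S → S → ℝ) (v : S → S → (Fin n → ℤ)) (f : S × (Fin n → ℤ) → ℝ) : ℝ :=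
  (1 / 2) * ∑' x : S × (Fin n → ℤ),
    ∑ j ∈ Finset.univ.erase x.1,
      (f x * q x.1 j - f (j, x.2 + v x.1 j) * q j x.1) *
        Real.log ((f x * q x.1 j) / (f (j, x.2 + v x.1 j) * q j x.1))

/-- Entropy production rate of the folded (finite) chain at a distribution `g`. -/
def epBar {S : Type} [Fintype S] [DecidableEq S] (q : S → S → ℝ) (g : S → ℝ) : ℝ :=
  (1 / 2) * ∑ i : S, ∑ j ∈ Finset.univ.erase i,
    (g i * q i j - g j * q j i) * Real.log ((g i * q i j) / (g j * q j i))

/-- Free energy of `f` on the lifted chain w.r.t. the periodic measure `π(i,α) = π̄ i`. -/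
def freeEnergyL {S : Type} [Fintype S] [DecidableEq S] {n : ℕ}
    (πb : S → ℝ) (f : S × (Fin n → ℤ) → ℝ) : ℝ :=
  ∑' x : S × (Fin n → ℤ), f x * Real.log (f x / πb x.1)

/-- Free energy of the folded distribution `g` w.r.t. `π̄`. -/
def freeEnergyBar {S : Type} [Fintype S] (πb : S → ℝ) (g : S → ℝ) : ℝ :=
  ∑ i : S, g i * Real.log (g i / πb i)

/-- The folded distribution on `S` of a distribution on `S × ℤ^n`. -/
def foldD {S : Type} {n : ℕ} (f : S × (Fin n → ℤ) → ℝ) (i : S) : ℝ :=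
  ∑' α : Fin n → ℤ, f (i, α)

/-- Entropy of a distribution on a countable set. -/
def Hent {X : Type*} (r : X → ℝ) : ℝ := ∑' x, Real.negMulLog (r x)

theorem flux_mul_log_nonneg {a b : ℝ} (ha : 0 ≤ a) (hb : 0 ≤ b) :
    0 ≤ (a - b) * Real.log (a / b) := by
  rcases ha.eq_or_lt with rfl | ha
  · simp
  rcases hb.eq_or_lt with rfl | hb
  · simp
  rcases le_total a b with h | h
  · exact mul_nonneg_of_nonpos_of_nonpos (sub_nonpos.2 h)
      (Real.log_nonpos (by positivity) ((div_le_one hb).2 h))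
  · exact mul_nonneg (sub_nonneg.2 h) (Real.log_nonneg ((one_le_div hb).2 h))

/-- Tangent-plane inequality for the convex, `1`-homogeneous function
`(a, b) ↦ (a - b) * log (a / b)`. -/
theorem tangent_le_flux_mul_log {a b A B : ℝ} (ha : 0 < a) (hb : 0 < b)
    (hA : 0 < A) (hB : 0 < B) :
    (Real.log (A / B) + 1 - B / A) * a + (-Real.log (A / B) + 1 - A / B) * b
      ≤ (a - b) * Real.log (a / b) := by
  have h1 : Real.log ((A / B) / (a / b)) ≤ (A / B) / (a / b) - 1 :=
    Real.log_le_sub_one_of_pos (by positivity)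
  have h2 : Real.log ((a / b) / (A / B)) ≤ (a / b) / (A / B) - 1 :=
    Real.log_le_sub_one_of_pos (by positivity)
  rw [Real.log_div (by positivity) (by positivity)] at h1 h2
  have h3 := mul_le_mul_of_nonneg_left h1 ha.le
  have h4 := mul_le_mul_of_nonneg_left h2 hb.le
  have e3 : a * ((A / B) / (a / b) - 1) = A / B * b - a := by field_simp
  have e4 : b * ((a / b) / (A / B) - 1) = B / A * a - b := by field_simp
  rw [e3] at h3
  rw [e4] at h4
  linarith

/-- Log-sum inequality for `(a, b) ↦ (a - b) * log (a / b)`. -/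
theorem flux_mul_log_tsum_le {ι : Type*} {a b : ι → ℝ} (ha : ∀ x, 0 ≤ a x)
    (hb : ∀ x, 0 ≤ b x) (hab : ∀ x, a x = 0 ↔ b x = 0) (hsa : Summable a) (hsb : Summable b)
    (hs : Summable fun x => (a x - b x) * Real.log (a x / b x)) :
    (∑' x, a x - ∑' x, b x) * Real.log ((∑' x, a x) / ∑' x, b x)
      ≤ ∑' x, (a x - b x) * Real.log (a x / b x) := by
  have hR : 0 ≤ ∑' x, (a x - b x) * Real.log (a x / b x) :=
    tsum_nonneg fun x => flux_mul_log_nonneg (ha x) (hb x)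
  rcases (tsum_nonneg ha).eq_or_lt with hA | hA
  · rw [← hA]; simpa using hR
  rcases (tsum_nonneg hb).eq_or_lt with hB | hB
  · rw [← hB]; simpa using hR
  set A := ∑' x, a x
  set B := ∑' x, b x
  have key := ((hsa.mul_left (Real.log (A / B) + 1 - B / A)).add
    (hsb.mul_left (-Real.log (A / B) + 1 - A / B))).tsum_le_tsum (g := fun x =>
      (a x - b x) * Real.log (a x / b x)) (fun x => ?_) hs
  · rw [(hsa.mul_left _).tsum_add (hsb.mul_left _), tsum_mul_left, tsum_mul_left] at key
    refine le_trans (le_of_eq ?_) key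
    change _ = (Real.log (A / B) + 1 - B / A) * A + (-Real.log (A / B) + 1 - A / B) * B
    field_simp
    ring
  · rcases (ha x).eq_or_lt with h0 | h0
    · simp [← h0, (hab x).1 h0.symm]
    · exact tangent_le_flux_mul_log h0
        ((hb x).lt_of_ne fun h => h0.ne' ((hab x).2 h.symm)) hA hB

section Lift

variable {S : Type} [Fintype S] [DecidableEq S] {n : ℕ}

theorem epBar_nonneg {q : S → S → ℝ} (hq : ∀ i j : S, i ≠ j → 0 ≤ q i j) {g : S → ℝ}
    (hg : ∀ i, 0 ≤ g i) : 0 ≤ epBar q g := by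
  refine mul_nonneg (by norm_num) (Finset.sum_nonneg fun i _ => Finset.sum_nonneg fun j hj => ?_)
  have hji := Finset.ne_of_mem_erase hj
  exact flux_mul_log_nonneg (mul_nonneg (hg i) (hq i j hji.symm)) (mul_nonneg (hg j) (hq j i hji))

/-- Folding does not increase the entropy production rate. -/
theorem epBar_foldD_le_epL {q : S → S → ℝ} (hq : ∀ i j : S, i ≠ j → 0 ≤ q i j)
    {v : S → S → (Fin n → ℤ)} {f : S × (Fin n → ℤ) → ℝ} (hf : ∀ x, 0 ≤ f x) (hfs : Summable f)
    (hzero : ∀ (x : S × (Fin n → ℤ)) (j : S), j ≠ x.1 →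
      (f x * q x.1 j = 0 ↔ f (j, x.2 + v x.1 j) * q j x.1 = 0))
    (hs : Summable (fun x : S × (Fin n → ℤ) =>
        ∑ j ∈ Finset.univ.erase x.1,
          (f x * q x.1 j - f (j, x.2 + v x.1 j) * q j x.1) *
            Real.log ((f x * q x.1 j) / (f (j, x.2 + v x.1 j) * q j x.1)))) :
    epBar q (foldD f) ≤ epL q v f := by
  have hterm : ∀ (x : S × (Fin n → ℤ)) (j : S), j ≠ x.1 →
      0 ≤ (f x * q x.1 j - f (j, x.2 + v x.1 j) * q j x.1) *
            Real.log ((f x * q x.1 j) / (f (j, x.2 + v x.1 j) * q j x.1)) := fun x j hj =>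
    flux_mul_log_nonneg (mul_nonneg (hf _) (hq _ _ hj.symm)) (mul_nonneg (hf _) (hq _ _ hj))
  have hfib : ∀ i, Summable fun α => f (i, α) := fun i =>
    hfs.comp_injective (Prod.mk_right_injective i)
  have hsi : ∀ i j : S, j ≠ i → Summable fun α : Fin n → ℤ =>
      (f (i, α) * q i j - f (j, α + v i j) * q j i) *
        Real.log ((f (i, α) * q i j) / (f (j, α + v i j) * q j i)) := fun i j hj =>
    Summable.of_nonneg_of_le (fun α => hterm (i, α) j hj)
      (fun α => Finset.single_le_sum (f := fun j =>
        (f (i, α) * q i j - f (j, α + v i j) * q j i) *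
          Real.log ((f (i, α) * q i j) / (f (j, α + v i j) * q j i)))
        (fun k hk => hterm (i, α) k (Finset.ne_of_mem_erase hk))
        (Finset.mem_erase.2 ⟨hj, Finset.mem_univ j⟩))
      (hs.comp_injective (Prod.mk_right_injective i))
  unfold epBar epL
  refine mul_le_mul_of_nonneg_left ?_ (by norm_num)
  rw [hs.tsum_prod, tsum_fintype]
  refine Finset.sum_le_sum fun i _ => ?_
  rw [Summable.tsum_finsetSum fun j hj => hsi i j (Finset.ne_of_mem_erase hj)]
  refine Finset.sum_le_sum fun j hj => ?_
  have hj := Finset.ne_of_mem_erase hj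
  have hshift : Summable fun α => f (j, α + v i j) :=
    (hfib j).comp_injective (add_left_injective (v i j))
  have e1 : foldD f i * q i j = ∑' α, f (i, α) * q i j := by
    rw [tsum_mul_right]; rfl
  have e2 : foldD f j * q j i = ∑' α, f (j, α + v i j) * q j i := by
    rw [tsum_mul_right]
    exact congrArg (· * q j i) ((Equiv.addRight (v i j)).tsum_eq fun α => f (j, α)).symm
  rw [e1, e2]
  exact flux_mul_log_tsum_le (fun α => mul_nonneg (hf _) (hq _ _ hj.symm))
    (fun α => mul_nonneg (hf _) (hq _ _ hj)) (fun α => hzero (i, α) j hj)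
    ((hfib i).mul_right _) (hshift.mul_right _) (hsi i j hj)

theorem IsMasterSolution.summable {q : S → S → ℝ} {v : S → S → (Fin n → ℤ)}
    {p : ℝ → S × (Fin n → ℤ) → ℝ} (hp : IsMasterSolution q v p) {t : ℝ} (ht : 0 ≤ t) :
    Summable (p t) := by
  by_contra h
  have := (hp.1 t ht).2
  rw [tsum_eq_zero_of_not_summable h] at this
  exact zero_ne_one this

/-- At positive times, a state of zero probability receives no probability flow. -/
theorem IsMasterSolution.inflow_eq_zero {q : S → S → ℝ} (hq : ∀ i j : S, i ≠ j → 0 ≤ q i j)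
    {v : S → S → (Fin n → ℤ)} {p : ℝ → S × (Fin n → ℤ) → ℝ} (hp : IsMasterSolution q v p)
    {t : ℝ} (ht : 0 < t) {x : S × (Fin n → ℤ)} (hx : p t x = 0) {j : S} (hj : j ≠ x.1) :
    p t (j, x.2 + v x.1 j) * q j x.1 = 0 := by
  have hd : HasDerivAt (fun s => p s x) (mEqDeriv q v (p t) x) t :=
    (hp.2 x t ht.le).hasDerivAt (Ici_mem_nhds ht)
  have hmin : IsLocalMin (fun s => p s x) t := by
    filter_upwards [Ioi_mem_nhds ht] with s hs
    rw [hx]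
    exact (hp.1 s (le_of_lt hs)).1 x
  have h0 := hmin.hasDerivAt_eq_zero hd
  unfold mEqDeriv at h0
  simp only [hx, zero_mul, sub_zero] at h0
  exact (Finset.sum_eq_zero_iff_of_nonneg fun k hk =>
    mul_nonneg ((hp.1 t ht.le).1 _) (hq _ _ (Finset.ne_of_mem_erase hk))).1 h0 j
      (Finset.mem_erase.2 ⟨hj, Finset.mem_univ j⟩)

theorem IsMasterSolution.flux_eq_zero_iff {q : S → S → ℝ} (hq : ∀ i j : S, i ≠ j → 0 ≤ q i j)
    (hq_sym : ∀ i j : S, i ≠ j → (0 < q i j ↔ 0 < q j i))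
    {v : S → S → (Fin n → ℤ)} (hv : ∀ i j, v j i = -(v i j))
    {p : ℝ → S × (Fin n → ℤ) → ℝ} (hp : IsMasterSolution q v p)
    {t : ℝ} (ht : 0 < t) (x : S × (Fin n → ℤ)) (j : S) (hj : j ≠ x.1) :
    p t x * q x.1 j = 0 ↔ p t (j, x.2 + v x.1 j) * q j x.1 = 0 := by
  have hq0 : q x.1 j = 0 ↔ q j x.1 = 0 := by
    have h := hq_sym x.1 j hj.symm
    rw [(hq x.1 j hj.symm).lt_iff_ne', (hq j x.1 hj).lt_iff_ne'] at h
    exact not_iff_not.1 h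
  constructor
  · intro h
    rcases mul_eq_zero.1 h with h | h
    · exact hp.inflow_eq_zero hq ht h hj
    · rw [hq0.1 h, mul_zero]
  · intro h
    rcases mul_eq_zero.1 h with h | h
    · simpa [hv x.1 j] using hp.inflow_eq_zero hq ht h (j := x.1) hj.symm
    · rw [hq0.2 h, mul_zero]

theorem IsMasterSolution.aemeasurable_foldD {q : S → S → ℝ} {v : S → S → (Fin n → ℤ)}
    {p : ℝ → S × (Fin n → ℤ) → ℝ} (hp : IsMasterSolution q v p) (i : S) :
    AEMeasurable (fun t => foldD (p t) i) (volume.restrict (Set.Ici 0)) := by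
  refine aemeasurable_of_tendsto_metrizable_ae (u := atTop)
    (f := fun (s : Finset (Fin n → ℤ)) t => ∑ α ∈ s, p t (i, α)) (fun s => ?_) ?_
  · refine Finset.aemeasurable_fun_sum _ fun α _ => ?_
    exact ContinuousOn.aemeasurable
      (fun t ht => (hp.2 (i, α) t ht).continuousWithinAt) measurableSet_Ici
  · filter_upwards [ae_restrict_mem measurableSet_Ici] with t ht
    exact ((hp.summable ht).comp_injective (Prod.mk_right_injective i)).hasSum

theorem intervalIntegrable_epBar_foldD {q : S → S → ℝ} (hq : ∀ i j : S, i ≠ j → 0 ≤ q i j)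
    (hq_sym : ∀ i j : S, i ≠ j → (0 < q i j ↔ 0 < q j i))
    {v : S → S → (Fin n → ℤ)} (hv : ∀ i j, v j i = -(v i j))
    {p : ℝ → S × (Fin n → ℤ) → ℝ} (hp : IsMasterSolution q v p)
    (hepfin : ∀ t : ℝ, 0 ≤ t →
      Summable (fun x : S × (Fin n → ℤ) =>
        ∑ j ∈ Finset.univ.erase x.1,
          (p t x * q x.1 j - p t (j, x.2 + v x.1 j) * q j x.1) *
            Real.log ((p t x * q x.1 j) / (p t (j, x.2 + v x.1 j) * q j x.1))))
    {T : ℝ} (hT : 0 < T) (hep : IntervalIntegrable (fun t => epL q v (p t)) volume 0 T) :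
    IntervalIntegrable (fun t => epBar q (foldD (p t))) volume 0 T := by
  have hsub : Set.uIoc 0 T ⊆ Set.Ici 0 := by
    rw [Set.uIoc_of_le hT.le]
    exact fun t ht => ht.1.le
  have hm : ∀ i, AEMeasurable (fun t => foldD (p t) i) (volume.restrict (Set.uIoc 0 T)) :=
    fun i => (hp.aemeasurable_foldD i).mono_measure (Measure.restrict_mono_set _ hsub)
  refine hep.mono_fun ?_ ?_
  · refine AEMeasurable.aestronglyMeasurable ?_
    unfold epBar
    refine AEMeasurable.const_mul (Finset.aemeasurable_fun_sum _ fun i _ =>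
      Finset.aemeasurable_fun_sum _ fun j _ => ?_) _
    exact (((hm i).mul_const _).sub ((hm j).mul_const _)).mul
      (Real.measurable_log.comp_aemeasurable (((hm i).mul_const _).div ((hm j).mul_const _)))
  · filter_upwards [ae_restrict_mem measurableSet_uIoc] with t ht
    rw [Set.uIoc_of_le hT.le] at ht
    have h := epBar_foldD_le_epL hq (hp.1 t ht.1.le).1 (hp.summable ht.1.le)
      (hp.flux_eq_zero_iff hq hq_sym hv ht.1) (hepfin t ht.1.le)
    have h0 : 0 ≤ epBar q (foldD (p t)) :=
      epBar_nonneg hq fun i => tsum_nonneg fun α => (hp.1 t ht.1.le).1 _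
    rw [Real.norm_of_nonneg h0, Real.norm_of_nonneg (h0.trans h)]
    exact h

/-- The entropy production rate of the folded chain is continuous at positive distributions. -/
theorem tendsto_epBar {ι : Type*} {l : Filter ι} {q : S → S → ℝ}
    (hq : ∀ i j : S, i ≠ j → 0 ≤ q i j)
    (hq_sym : ∀ i j : S, i ≠ j → (0 < q i j ↔ 0 < q j i))
    {πb : S → ℝ} (hπ : ∀ i, 0 < πb i) {g : ι → S → ℝ}
    (hg : ∀ i, Tendsto (fun t => g t i) l (nhds (πb i))) :
    Tendsto (fun t => epBar q (g t)) l (nhds (epBar q πb)) := by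
  unfold epBar
  refine (tendsto_finsetSum _ fun i _ => tendsto_finsetSum _ fun j hj => ?_).const_mul _
  have hj := Finset.ne_of_mem_erase hj
  rcases (hq i j hj.symm).eq_or_lt with h | h
  · simp only [← h, mul_zero, zero_div, Real.log_zero]
    exact tendsto_const_nhds
  have h' := (hq_sym i j hj.symm).1 h
  have hi := (hg i).mul_const (q i j)
  have hk := (hg j).mul_const (q j i)
  have hpi := mul_pos (hπ i) h
  have hpj := mul_pos (hπ j) h'
  exact (hi.sub hk).mul ((hi.div hk hpj.ne').log (div_pos hpi hpj).ne')

end Lift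

theorem tendsto_freeEnergyBar {S : Type} [Fintype S] {ι : Type*} {l : Filter ι}
    {πb : S → ℝ} (hπ : ∀ i, 0 < πb i) {g : ι → S → ℝ} (hg : ∀ i, Tendsto (fun t => g t i) l (nhds (πb i))) :
    Tendsto (fun t => freeEnergyBar πb (g t)) l (nhds (freeEnergyBar πb πb)) :=
  tendsto_finsetSum _ fun i _ => (hg i).mul
    (((hg i).div_const (πb i)).log (div_pos (hπ i) (hπ i)).ne')

/-- The free energy splits into the entropy and the mean of `log π̄` under the folded
distribution. -/
theorem freeEnergyL_eq {S : Type} [Fintype S] [DecidableEq S] {n : ℕ} {πb : S → ℝ}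
    (hπ : ∀ i, 0 < πb i) {f : S × (Fin n → ℤ) → ℝ}
    (hfs : Summable f)
    (hF : Summable (fun x : S × (Fin n → ℤ) => f x * Real.log (f x / πb x.1))) :
    freeEnergyL πb f = -Hent f - ∑ i, foldD f i * Real.log (πb i) := by
  have hsplit : ∀ x : S × (Fin n → ℤ), f x * Real.log (πb x.1)
      = -Real.negMulLog (f x) - f x * Real.log (f x / πb x.1) := by
    intro x
    by_cases hx : f x = 0
    · simp [hx]
    · rw [Real.log_div hx (hπ _).ne', Real.negMulLog]
      ring
  have hL : Summable fun x : S × (Fin n → ℤ) => f x * Real.log (πb x.1) := by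
    refine (hfs.abs.mul_right (∑ i, |Real.log (πb i)|)).of_norm_bounded fun x => ?_
    rw [Real.norm_eq_abs, abs_mul]
    exact mul_le_mul_of_nonneg_left (Finset.single_le_sum (f := fun i => |Real.log (πb i)|)
      (fun i _ => abs_nonneg _) (Finset.mem_univ x.1)) (abs_nonneg _)
  have hmean : ∑' x : S × (Fin n → ℤ), f x * Real.log (πb x.1)
      = ∑ i, foldD f i * Real.log (πb i) := by
    rw [hL.tsum_prod, tsum_fintype]
    exact Finset.sum_congr rfl fun i _ =>
      tsum_mul_right (f := fun α => f (i, α)) (a := Real.log (πb i))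
  have hH : Hent f = -∑' x : S × (Fin n → ℤ),
      (f x * Real.log (f x / πb x.1) + f x * Real.log (πb x.1)) := by
    rw [Hent, ← tsum_neg]
    refine tsum_congr fun x => ?_
    rw [hsplit]
    ring
  rw [hH, hF.tsum_add hL, hmean, freeEnergyL]
  ring

/-- Continuous Cesàro means of a convergent, locally integrable function converge. -/
theorem tendsto_cesaro_integral {g : ℝ → ℝ} {L : ℝ}
    (hg : ∀ T : ℝ, 0 < T → IntervalIntegrable g volume 0 T) (hlim : Tendsto g atTop (nhds L)) :
    Tendsto (fun T : ℝ => (1 / T) * ∫ t in (0:ℝ)..T, g t) atTop (nhds L) := by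
  rw [Metric.tendsto_atTop]
  intro ε hε
  obtain ⟨N, hN⟩ := Metric.tendsto_atTop.1 hlim (ε / 2) (half_pos hε)
  set M := max N 1
  have hM : 0 < M := lt_of_lt_of_le one_pos (le_max_right _ _)
  set C := |∫ t in (0:ℝ)..M, (g t - L)|
  refine ⟨max M (2 * C / ε + 1), fun T hT => ?_⟩
  have hMT : M ≤ T := (le_max_left _ _).trans hT
  have hT0 : 0 < T := hM.trans_le hMT
  have hCT : 2 * C / ε < T := by linarith [(le_max_right M (2 * C / ε + 1)).trans hT]
  have hi : ∀ T : ℝ, 0 < T → IntervalIntegrable (fun t => g t - L) volume 0 T :=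
    fun T h => (hg T h).sub intervalIntegrable_const
  have htail : |∫ t in M..T, (g t - L)| ≤ ε / 2 * (T - M) := by
    have := intervalIntegral.norm_integral_le_of_norm_le_const (a := M) (b := T)
      (f := fun t => g t - L) (C := ε / 2) fun t ht => by
        rw [Set.uIoc_of_le hMT] at ht
        exact (hN t ((le_max_left _ _).trans ht.1.le)).le
    rwa [abs_of_nonneg (sub_nonneg.2 hMT)] at this
  have hsplit : ∫ t in (0:ℝ)..T, (g t - L)
      = (∫ t in (0:ℝ)..M, (g t - L)) + ∫ t in M..T, (g t - L) :=
    (intervalIntegral.integral_add_adjacent_intervals (hi M hM)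
      ((hi M hM).symm.trans (hi T hT0))).symm
  have hsub : ∫ t in (0:ℝ)..T, (g t - L) = (∫ t in (0:ℝ)..T, g t) - T * L := by
    rw [intervalIntegral.integral_sub (hg T hT0) intervalIntegrable_const]
    simp
  have heq : (1 / T) * (∫ t in (0:ℝ)..T, g t) - L = (∫ t in (0:ℝ)..T, (g t - L)) / T := by
    rw [hsub]
    field_simp
  rw [Real.dist_eq, heq, abs_div, abs_of_pos hT0, div_lt_iff₀ hT0, hsplit]
  refine (abs_add_le _ _).trans_lt ?_
  rw [div_lt_iff₀ hε] at hCT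
  have : 0 < ε / 2 * M := by positivity
  linarith

theorem stmt_4 {S : Type} [Fintype S] [DecidableEq S] (hS : 2 ≤ Fintype.card S) {n : ℕ}
    (q : S → S → ℝ)
    (hq_nonneg : ∀ i j : S, i ≠ j → 0 ≤ q i j)
    (hq_sym : ∀ i j : S, i ≠ j → (0 < q i j ↔ 0 < q j i))
    (hq_conn : ∀ i j : S, Relation.ReflTransGen (fun a b => a ≠ b ∧ 0 < q a b) i j)
    (πb : S → ℝ) (hπpos : ∀ i, 0 < πb i) (hπsum : ∑ i, πb i = 1)
    (hπstat : ∀ j : S,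
      ∑ i ∈ Finset.univ.erase j, (πb i * q i j - πb j * q j i) = 0)
    (v : S → S → (Fin n → ℤ)) (hv : ∀ i j, v j i = -(v i j))
    (p : ℝ → S × (Fin n → ℤ) → ℝ) (hp : IsMasterSolution q v p)
    -- the initial distribution has finite entropy:
    (hH0 : Summable (fun x => Real.negMulLog (p 0 x)))
    -- (i) for every t ≥ 0 the free energy is finite and e_p(t) is finite
    --     and locally integrable:
    (hFfin : ∀ t : ℝ, 0 ≤ t →
      Summable (fun x : S × (Fin n → ℤ) => p t x * Real.log (p t x / πb x.1)))
    (hepfin : ∀ t : ℝ, 0 ≤ t →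
      Summable (fun x : S × (Fin n → ℤ) =>
        ∑ j ∈ Finset.univ.erase x.1,
          (p t x * q x.1 j - p t (j, x.2 + v x.1 j) * q j x.1) *
            Real.log ((p t x * q x.1 j) / (p t (j, x.2 + v x.1 j) * q j x.1))))
    (heploc : ∀ T : ℝ, 0 < T →
      IntervalIntegrable (fun t => epL q v (p t)) volume 0 T)
    -- (ii) the free-energy balance identity:
    (hbalance : ∀ T : ℝ, 0 < T →
      freeEnergyL πb (p T) - freeEnergyL πb (p 0)
          + ∫ t in (0:ℝ)..T, epL q v (p t)
        = freeEnergyBar πb (foldD (p T)) - freeEnergyBar πb (foldD (p 0))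
          + ∫ t in (0:ℝ)..T, epBar q (foldD (p t)))
    -- (iii) the folded distribution converges pointwise to π̄:
    (hfold : ∀ i : S, Tendsto (fun t => foldD (p t) i) atTop (nhds (πb i))) :
    -- Cesàro convergence of e_p to ē_p iff H[p(T)]/T → 0:
    Tendsto (fun T : ℝ => (1 / T) * ∫ t in (0:ℝ)..T, epL q v (p t))
        atTop (nhds (epBar q πb))
      ↔ Tendsto (fun T : ℝ => Hent (p T) / T) atTop (nhds 0) := by
  set g := fun t => epBar q (foldD (p t))
  have hces : Tendsto (fun T : ℝ => (1 / T) * ∫ t in (0:ℝ)..T, g t) atTop (nhds (epBar q πb)) :=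
    tendsto_cesaro_integral
      (fun T hT => intervalIntegrable_epBar_foldD hq_nonneg hq_sym hv hp hepfin hT (heploc T hT))
      (tendsto_epBar hq_nonneg hq_sym hπpos hfold)
  set R : ℝ → ℝ := fun T => (∑ i, foldD (p T) i * Real.log (πb i)) + freeEnergyL πb (p 0)
    + freeEnergyBar πb (foldD (p T)) - freeEnergyBar πb (foldD (p 0)) with hR
  have hRT : Tendsto (fun T => R T / T) atTop (nhds 0) := by
    refine Tendsto.div_atTop (a := (∑ i, πb i * Real.log (πb i)) + freeEnergyL πb (p 0)
      + freeEnergyBar πb πb - freeEnergyBar πb (foldD (p 0))) ?_ tendsto_id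
    exact (((tendsto_finsetSum _ fun i _ => (hfold i).mul_const _).add_const _).add
      (tendsto_freeEnergyBar hπpos hfold)).sub_const _
  have hrest : Tendsto (fun T : ℝ => R T / T + (1 / T) * ∫ t in (0:ℝ)..T, g t) atTop
      (nhds (epBar q πb)) := by
    simpa using hRT.add hces
  have hid : (fun T : ℝ => (1 / T) * ∫ t in (0:ℝ)..T, epL q v (p t)) =ᶠ[atTop]
      fun T => Hent (p T) / T + (R T / T + (1 / T) * ∫ t in (0:ℝ)..T, g t) := by
    filter_upwards [eventually_gt_atTop 0] with T hT
    have hb := hbalance T hT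
    have hF := freeEnergyL_eq hπpos (hp.summable hT.le) (hFfin T hT.le)
    have hint : ∫ t in (0:ℝ)..T, epL q v (p t)
        = Hent (p T) + R T + ∫ t in (0:ℝ)..T, g t := by
      simp only [hR]
      linarith
    rw [hint]
    ring
  rw [tendsto_congr' hid]
  constructor
  · intro h
    simpa using h.sub hrest
  · intro h
    simpa using h.add hrest

end
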